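/- Let d ≥ 1 be an integer, β > 0 a non-integer real with fractional part ν = β − ⌊β⌋ ∈ (0,1), and L > 0. There exists a constant c(β) > 0 depending only on β (and not on d); explicitly one may take c(β) = (2π)^{−2⌊β⌋}·2^{2ν}·3^{−ν}/(1 − 2^{−2ν}); such that for every f ∈ S_L^p(β) (fractional periodic Sobolev space) and every integer M ≥ 1, Σ_{k ∈ ℤ^d \ {−M,…,M}^d} |θ_k(f)|² ≤ c(β)·d·(M+1)^{−2β}·L². -/

import Mathlib

open MeasureTheory Real Complex Finset

noncomputable section

def cube (d : ℕ) : Set (Fin d → ℝ) := Set.Icc 0 1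

def phi (d : ℕ) (k : Fin d → ℤ) (x : Fin d → ℝ) : ℂ :=
  Complex.exp (Complex.I * (2 * Real.pi) * ∑ i, (k i : ℂ) * (x i : ℂ))

/-- The `k`-th Fourier coefficient `θ_k(g) = ∫_{[0,1]^d} g(x) e^{-2iπ⟨k,x⟩} dx`. -/
def fCoeff (d : ℕ) (g : (Fin d → ℝ) → ℂ) (k : Fin d → ℤ) : ℂ :=
  ∫ x in cube d, g x * (starRingEnd ℂ) (phi d k x)

def box (d M : ℕ) : Finset (Fin d → ℤ) :=
  Fintype.piFinset fun _ => Finset.Icc (-(M : ℤ)) (M : ℤ)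

/-- The Euclidean distance on `ℝ^d`. -/
def euclid (d : ℕ) (x y : Fin d → ℝ) : ℝ := Real.sqrt (∑ i, (x i - y i) ^ 2)

/-- Partial derivative in the `i`-th coordinate direction. -/
def pderiv (d : ℕ) (i : Fin d) (g : (Fin d → ℝ) → ℝ) : (Fin d → ℝ) → ℝ :=
  fun x => deriv (fun t => g (Function.update x i t)) (x i)

/-- Iterated partial derivative `∂^α g` for the multi-index `α`. -/
def mderiv (d : ℕ) (α : Fin d → ℕ) (g : (Fin d → ℝ) → ℝ) : (Fin d → ℝ) → ℝ :=
  (List.finRange d).foldr (fun i h => (pderiv d i)^[α i] h) g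

/-- The finite set of multi-indices `α ∈ ℕ^d` with `|α| = β`. -/
def multiIdx (d β : ℕ) : Finset (Fin d → ℕ) :=
  (Fintype.piFinset fun _ : Fin d => Finset.range (β + 1)).filter fun α => ∑ i, α i = β

/-- The fractional periodic Sobolev ball `S_L^p(β)` for real `β = ⌊β⌋ + ν`, `ν ∈ (0,1)`:
`f ∈ C^{⌊β⌋}`, there are Hölder constants `H_α` of exponent `ν` for the derivatives of
order `⌊β⌋` with `Σ_α ‖∂^α f‖₂² + Σ_α H_α² ≤ L²`, and all derivatives of order `≤ ⌊β⌋`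
satisfy the periodic boundary condition on `[0,1]^d`. -/
def SobolevFracP (d : ℕ) (β L : ℝ) (f : (Fin d → ℝ) → ℝ) : Prop :=
  ContDiff ℝ (⌊β⌋₊ : ℕ∞) f ∧
  (∃ H : (Fin d → ℕ) → ℝ,
    (∀ α ∈ multiIdx d ⌊β⌋₊, 0 ≤ H α ∧ ∀ x ∈ cube d, ∀ y ∈ cube d,
        |mderiv d α f x - mderiv d α f y| ≤ H α * euclid d x y ^ (β - ⌊β⌋₊)) ∧
    (∑ α ∈ multiIdx d ⌊β⌋₊, ∫ x in cube d, (mderiv d α f x) ^ 2)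
        + (∑ α ∈ multiIdx d ⌊β⌋₊, H α ^ 2) ≤ L ^ 2) ∧
  ∀ α : Fin d → ℕ, (∑ i, α i) ≤ ⌊β⌋₊ →
    ∀ x ∈ cube d, ∀ i : Fin d, (x i = 0 ∨ x i = 1) →
      mderiv d α f x = mderiv d α f (Function.update x i (1 - x i))

instance isProbabilityMeasure_restrict_Icc :
    IsProbabilityMeasure (volume.restrict (Set.Icc (0 : ℝ) 1)) :=
  ⟨by simp⟩

lemma volume_restrict_cube (d : ℕ) :
    (volume.restrict (cube d) : Measure (Fin d → ℝ)) =
      Measure.pi fun _ : Fin d => volume.restrict (Set.Icc (0 : ℝ) 1) := by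
  rw [cube, ← Set.pi_univ_Icc, volume_pi, Measure.restrict_pi_pi]
  rfl

instance isProbabilityMeasure_restrict_cube (d : ℕ) :
    IsProbabilityMeasure (volume.restrict (cube d) : Measure (Fin d → ℝ)) := by
  rw [volume_restrict_cube]
  infer_instance

lemma measurableSet_cube (d : ℕ) : MeasurableSet (cube d) := measurableSet_Icc

lemma measurable_update_prod {d : ℕ} (i : Fin d) :
    Measurable fun p : (Fin d → ℝ) × ℝ => Function.update p.1 i p.2 := by
  refine measurable_pi_lambda _ fun j => ?_
  by_cases hj : j = i
  · subst hj
    simpa using measurable_snd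
  · simpa [Function.update_of_ne hj, Function.comp_def] using
      (measurable_pi_apply j).comp (measurable_fst (α := Fin d → ℝ) (β := ℝ))

lemma measurable_shift {d : ℕ} (i : Fin d) (h : ℝ) :
    Measurable fun x : Fin d → ℝ => Function.update x i (Int.fract (x i + h)) := by
  have h0 : Measurable fun x : Fin d → ℝ => x i + h := by fun_prop
  have h1 : Measurable fun x : Fin d → ℝ => (x, Int.fract (x i + h)) :=
    measurable_id.prodMk h0.fract
  exact (measurable_update_prod i).comp h1

/-- Resampling one coordinate of a uniform point of the cube leaves its law unchanged. -/
lemma measurePreserving_update {d : ℕ} (i : Fin d) :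
    MeasurePreserving (fun p : (Fin d → ℝ) × ℝ => Function.update p.1 i p.2)
      ((volume.restrict (cube d)).prod (volume.restrict (Set.Icc (0 : ℝ) 1)))
      (volume.restrict (cube d)) := by
  refine ⟨measurable_update_prod i, ?_⟩
  rw [volume_restrict_cube]
  symm
  refine Measure.pi_eq fun s hs => ?_
  rw [Measure.map_apply (measurable_update_prod i) (MeasurableSet.univ_pi hs)]
  have : (fun p : (Fin d → ℝ) × ℝ => Function.update p.1 i p.2) ⁻¹' Set.univ.pi s =
      (Set.univ.pi (Function.update s i Set.univ)) ×ˢ s i := by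
    ext ⟨x, t⟩
    simp only [Set.mem_preimage, Set.mem_univ_pi, Set.mem_prod]
    constructor
    · intro h
      refine ⟨fun j => ?_, by simpa using h i⟩
      by_cases hj : j = i
      · subst hj; simp
      · simpa [Function.update_of_ne hj] using h j
    · rintro ⟨h, ht⟩ j
      by_cases hj : j = i
      · subst hj; simpa using ht
      · simpa [Function.update_of_ne hj] using h j
  rw [this, Measure.prod_prod, Measure.pi_pi, ← Finset.mul_prod_erase _ _ (Finset.mem_univ i),
    ← Finset.mul_prod_erase (a := i) _ (fun j => (volume.restrict (Set.Icc (0 : ℝ) 1)) (s j))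
      (Finset.mem_univ i), Function.update_self, measure_univ, one_mul, mul_comm]
  congr 1
  refine Finset.prod_congr rfl fun j hj => ?_
  rw [Function.update_of_ne (Finset.ne_of_mem_erase hj)]

lemma setIntegral_cube_eq_update {d : ℕ} (i : Fin d) {E : Type*} [NormedAddCommGroup E]
    [NormedSpace ℝ E] {F : (Fin d → ℝ) → E} (hF : IntegrableOn F (cube d)) :
    ∫ x in cube d, F x = ∫ x in cube d, ∫ t in (0 : ℝ)..1, F (Function.update x i t) := by
  have hmp := measurePreserving_update i
  have h1 := integral_map (μ := (volume.restrict (cube d)).prod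
    (volume.restrict (Set.Icc (0 : ℝ) 1))) hmp.measurable.aemeasurable
    (f := F) (by rw [hmp.map_eq]; exact hF.aestronglyMeasurable)
  rw [hmp.map_eq] at h1
  rw [h1, integral_prod]
  · refine integral_congr_ae (Filter.Eventually.of_forall fun x => ?_)
    simp only
    rw [intervalIntegral.integral_of_le zero_le_one, integral_Icc_eq_integral_Ioc]
  · exact (hmp.integrable_comp hF.aestronglyMeasurable).2 hF

lemma phi_update {d : ℕ} (k : Fin d → ℤ) (i : Fin d) (x : Fin d → ℝ) (t : ℝ) :
    phi d k (Function.update x i t) =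
      phi d k (Function.update x i 0) * Complex.exp (2 * π * Complex.I * k i * t) := by
  have hsum : ∀ s : ℝ, ∑ j, (k j : ℂ) * ((Function.update x i s j : ℝ) : ℂ) =
      k i * s + ∑ j ∈ Finset.univ.erase i, (k j : ℂ) * x j := by
    intro s
    rw [← Finset.add_sum_erase _ _ (Finset.mem_univ i), Function.update_self]
    congr 1
    refine Finset.sum_congr rfl fun j hj => ?_
    rw [Function.update_of_ne (Finset.ne_of_mem_erase hj)]
  rw [phi, phi, hsum, hsum, ← Complex.exp_add]
  congr 1
  push_cast
  ring

lemma norm_phi {d : ℕ} (k : Fin d → ℤ) (x : Fin d → ℝ) : ‖phi d k x‖ = 1 := by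
  have : Complex.I * (2 * π) * ∑ i, (k i : ℂ) * (x i : ℂ) =
      ((2 * π * ∑ i, (k i : ℝ) * x i : ℝ) : ℂ) * Complex.I := by
    push_cast; ring
  rw [phi, this, Complex.norm_exp_ofReal_mul_I]

lemma continuous_phi {d : ℕ} (k : Fin d → ℤ) : Continuous (phi d k) := by
  unfold phi
  fun_prop

lemma phi_mul_conj {d : ℕ} (k l : Fin d → ℤ) (x : Fin d → ℝ) :
    phi d k x * (starRingEnd ℂ) (phi d l x) = phi d (k - l) x := by
  rw [phi, phi, phi, ← Complex.exp_conj, ← Complex.exp_add]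
  congr 1
  simp only [map_mul, map_sum, Complex.conj_I, Complex.conj_ofReal, map_ofNat, Pi.sub_apply,
    Int.cast_sub, sub_mul, Finset.sum_sub_distrib, map_intCast]
  ring

lemma exp_two_pi_int (n : ℤ) : Complex.exp (2 * π * Complex.I * n) = 1 := by
  rw [mul_comm]
  exact Complex.exp_int_mul_two_pi_mul_I n

lemma integral_phi {d : ℕ} (k : Fin d → ℤ) :
    ∫ x in cube d, phi d k x = if k = 0 then 1 else 0 := by
  split_ifs with hk
  · subst hk
    simp [phi]
  · obtain ⟨i, hi⟩ : ∃ i, k i ≠ 0 := by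
      by_contra! h
      exact hk (funext h)
    rw [setIntegral_cube_eq_update i
      ((continuous_phi k).continuousOn.integrableOn_compact isCompact_Icc)]
    refine integral_eq_zero_of_ae (Filter.Eventually.of_forall fun x => ?_)
    obtain ⟨A, hA⟩ : ∃ A : ℂ, ∀ t : ℝ, phi d k (Function.update x i t) =
        A * Complex.exp (2 * π * Complex.I * k i * t) := ⟨_, phi_update k i x⟩
    simp only [hA, intervalIntegral.integral_const_mul, Pi.zero_apply]
    have hc : (2 * π * Complex.I * k i : ℂ) ≠ 0 := by
      simp [hi, Real.pi_ne_zero]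
    rw [integral_exp_mul_complex hc]
    simp [exp_two_pi_int]

/-- Bessel's inequality for the trigonometric system on the cube. -/
lemma sum_norm_sq_fCoeff_le {d : ℕ} {g : (Fin d → ℝ) → ℂ}
    (hg : MemLp g 2 (volume.restrict (cube d))) (S : Finset (Fin d → ℤ)) :
    ∑ k ∈ S, ‖fCoeff d g k‖ ^ 2 ≤ ∫ x in cube d, ‖g x‖ ^ 2 := by
  have hm : ∀ k, MemLp (phi d k) 2 (volume.restrict (cube d)) := fun k =>
    MemLp.of_bound (continuous_phi k).aestronglyMeasurable 1
      (Filter.Eventually.of_forall fun x => (norm_phi k x).le)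
  have hin : ∀ (k : Fin d → ℤ) (u : (Fin d → ℝ) → ℂ) (hu : MemLp u 2 (volume.restrict (cube d))),
      inner ℂ ((hm k).toLp (phi d k)) (hu.toLp u) = fCoeff d u k := by
    intro k u hu
    rw [L2.inner_def, fCoeff]
    refine integral_congr_ae ?_
    filter_upwards [(hm k).coeFn_toLp, hu.coeFn_toLp] with x h1 h2
    rw [h1, h2]
    rfl
  have horth : Orthonormal ℂ fun k => (hm k).toLp (phi d k) := by
    rw [orthonormal_iff_ite]
    intro k l
    rw [hin, fCoeff]
    simp only [phi_mul_conj, integral_phi, sub_eq_zero]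
    exact if_congr eq_comm rfl rfl
  have := horth.sum_inner_products_le (hg.toLp g) (s := S)
  simp only [hin] at this
  refine this.trans (le_of_eq ?_)
  rw [← inner_self_eq_norm_sq (𝕜 := ℂ), L2.inner_def, ← integral_re (L2.integrable_inner _ _)]
  refine integral_congr_ae ?_
  filter_upwards [hg.coeFn_toLp] with x h1
  rw [h1, inner_self_eq_norm_sq]

/-- Translating one coordinate modulo one multiplies the Fourier coefficients by a phase. -/
lemma fCoeff_shift {d : ℕ} (i : Fin d) {g : (Fin d → ℝ) → ℂ} (hg : Continuous g) (h : ℝ)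
    (k : Fin d → ℤ) :
    fCoeff d (fun x => g (Function.update x i (Int.fract (x i + h)))) k =
      Complex.exp (2 * π * Complex.I * k i * h) * fCoeff d g k := by
  obtain ⟨C, hC⟩ := (isCompact_Icc (a := (0 : Fin d → ℝ)) (b := 1)).exists_bound_of_continuousOn
    hg.continuousOn
  have hi1 : IntegrableOn (fun x => g x * (starRingEnd ℂ) (phi d k x)) (cube d) :=
    (hg.mul (Complex.continuous_conj.comp (continuous_phi k))).continuousOn.integrableOn_compact
      isCompact_Icc
  have hmeas := measurable_shift i h
  have hi2 : IntegrableOn (fun x => g (Function.update x i (Int.fract (x i + h))) *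
      (starRingEnd ℂ) (phi d k x)) (cube d) := by
    refine Integrable.of_bound (((hg.measurable.comp hmeas).mul
      (Complex.continuous_conj.comp (continuous_phi k)).measurable).aestronglyMeasurable) C ?_
    filter_upwards [ae_restrict_mem (measurableSet_cube d)] with x hx
    rw [norm_mul, RCLike.norm_conj, norm_phi, mul_one]
    apply hC
    rw [← Set.pi_univ_Icc, Set.mem_univ_pi]
    intro j
    by_cases hj : j = i
    · subst hj
      simpa using (Int.fract_lt_one (x j + h)).le
    · simpa [Function.update_of_ne hj] using ⟨hx.1 j, hx.2 j⟩
  rw [fCoeff, fCoeff, setIntegral_cube_eq_update i hi1, setIntegral_cube_eq_update i hi2,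
    ← integral_const_mul]
  refine integral_congr_ae (Filter.Eventually.of_forall fun x => ?_)
  simp only [Function.update_idem, Function.update_self]
  set P : ℝ → ℂ := fun t => g (Function.update x i (Int.fract t)) *
    (starRingEnd ℂ) (phi d k (Function.update x i t)) with hP
  have hper : Function.Periodic P 1 := by
    intro t
    simp only [hP, Int.fract_add_one]
    rw [phi_update k i x (t + 1), phi_update k i x t]
    push_cast
    rw [mul_add, Complex.exp_add, mul_one, exp_two_pi_int, mul_one]
  have hexp : ∀ s : ℝ, Complex.exp (2 * π * Complex.I * k i * s) *
      (starRingEnd ℂ) (Complex.exp (2 * π * Complex.I * k i * s)) = 1 := by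
    intro s
    rw [← Complex.exp_conj, ← Complex.exp_add]
    simp [Complex.conj_ofNat]
  have h1 : ∀ t : ℝ, g (Function.update x i (Int.fract (t + h))) *
      (starRingEnd ℂ) (phi d k (Function.update x i t)) =
      Complex.exp (2 * π * Complex.I * k i * h) * P (t + h) := by
    intro t
    simp only [hP]
    rw [phi_update k i x (t + h), phi_update k i x t]
    push_cast
    rw [mul_add, Complex.exp_add]
    simp only [map_mul]
    linear_combination (-(g (Function.update x i (Int.fract (t + h))) *
      (starRingEnd ℂ) (phi d k (Function.update x i 0)) *
      (starRingEnd ℂ) (Complex.exp (2 * π * Complex.I * k i * t)))) * hexp h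
  simp only [h1, intervalIntegral.integral_const_mul]
  congr 1
  rw [intervalIntegral.integral_comp_add_right, zero_add, add_comm (1 : ℝ) h]
  have h2 := hper.intervalIntegral_add_eq h 0
  rw [h2, zero_add]
  refine intervalIntegral.integral_congr_ae ?_
  have : ∀ᵐ t : ℝ, t ≠ 1 := by simp [ae_iff]
  filter_upwards [this] with t ht hm
  rw [Set.uIoc_of_le zero_le_one] at hm
  simp only [hP]
  rw [Int.fract_eq_self.2 ⟨hm.1.le, lt_of_le_of_ne hm.2 ht⟩]

lemma update_mem_cube {d : ℕ} {x : Fin d → ℝ} (hx : x ∈ cube d) (i : Fin d) {t : ℝ}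
    (ht : t ∈ Set.Icc (0 : ℝ) 1) : Function.update x i t ∈ cube d := by
  rw [cube, ← Set.pi_univ_Icc, Set.mem_univ_pi]
  intro j
  by_cases hj : j = i
  · subst hj
    simpa using ht
  · simpa [Function.update_of_ne hj] using And.intro (hx.1 j) (hx.2 j)

lemma pderiv_eq_fderiv {d : ℕ} (i : Fin d) {G : (Fin d → ℝ) → ℝ} (hG : Differentiable ℝ G) :
    pderiv d i G = fun x => fderiv ℝ G x (Pi.single i 1) := by
  funext x
  have h := (hG (Function.update x i (x i))).hasFDerivAt.comp_hasDerivAt (x i)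
    (hasDerivAt_update x i (x i))
  rw [Function.update_eq_self] at h
  exact h.deriv

lemma ContDiff.pderiv {d : ℕ} (i : Fin d) {G : (Fin d → ℝ) → ℝ} {n : ℕ}
    (hG : ContDiff ℝ (n + 1 : ℕ) G) : ContDiff ℝ n (pderiv d i G) := by
  rw [pderiv_eq_fderiv i (hG.differentiable (by simp))]
  exact (hG.fderiv_right (m := n) (by norm_cast)).clm_apply contDiff_const

lemma ContDiff.pderiv_iterate {d : ℕ} (i : Fin d) {G : (Fin d → ℝ) → ℝ} (q : ℕ) {n : ℕ}
    (hG : ContDiff ℝ (n + q : ℕ) G) : ContDiff ℝ n ((_root_.pderiv d i)^[q] G) := by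
  induction q generalizing n with
  | zero => simpa using hG
  | succ q ih =>
    rw [Function.iterate_succ_apply']
    exact ContDiff.pderiv i (ih (n := n + 1) (by convert hG using 2; ring))

lemma mderiv_single {d : ℕ} (i : Fin d) (q : ℕ) (G : (Fin d → ℝ) → ℝ) :
    mderiv d (Pi.single i q) G = (pderiv d i)^[q] G := by
  have key : ∀ l : List (Fin d), l.Nodup →
      l.foldr (fun j h => (pderiv d j)^[(Pi.single i q : Fin d → ℕ) j] h) G =
        if i ∈ l then (pderiv d i)^[q] G else G := by
    intro l
    induction l with
    | nil => simp
    | cons a l ih =>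
      intro hl
      rw [List.nodup_cons] at hl
      rw [List.foldr_cons, ih hl.2]
      by_cases ha : a = i
      · subst ha
        simp [hl.1]
      · simp [ha, Ne.symm ha]
  rw [mderiv, key _ (List.nodup_finRange d), if_pos (List.mem_finRange i)]

lemma fCoeff_pderiv {d : ℕ} (i : Fin d) {G : (Fin d → ℝ) → ℝ} (hG : ContDiff ℝ 1 G)
    (hper : ∀ x ∈ cube d, G (Function.update x i 0) = G (Function.update x i 1))
    (k : Fin d → ℤ) :
    fCoeff d (fun x => (pderiv d i G x : ℂ)) k =
      2 * π * Complex.I * k i * fCoeff d (fun x => (G x : ℂ)) k := by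
  have hG' : Continuous (pderiv d i G) := (ContDiff.pderiv (n := 0) i (by simpa using hG)).continuous
  have hw : Continuous fun x => (starRingEnd ℂ) (phi d k x) :=
    Complex.continuous_conj.comp (continuous_phi k)
  have hi1 : IntegrableOn (fun x => (G x : ℂ) * (starRingEnd ℂ) (phi d k x)) (cube d) :=
    ((Complex.continuous_ofReal.comp hG.continuous).mul hw).continuousOn.integrableOn_compact
      isCompact_Icc
  have hi2 : IntegrableOn (fun x => (pderiv d i G x : ℂ) * (starRingEnd ℂ) (phi d k x)) (cube d) :=
    ((Complex.continuous_ofReal.comp hG').mul hw).continuousOn.integrableOn_compact isCompact_Icc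
  rw [fCoeff, fCoeff, setIntegral_cube_eq_update i hi1, setIntegral_cube_eq_update i hi2,
    ← integral_const_mul]
  refine integral_congr_ae ?_
  filter_upwards [ae_restrict_mem (measurableSet_cube d)] with x hx
  have hupd : Continuous fun t : ℝ => Function.update x i t := continuous_const.update i continuous_id
  have hu : ∀ t : ℝ, HasDerivAt (fun s : ℝ => (G (Function.update x i s) : ℂ))
      (pderiv d i G (Function.update x i t) : ℂ) t := by
    intro t
    have h := ((hG.differentiable (by simp)) (Function.update x i t)).hasFDerivAt.comp_hasDerivAt t
      (hasDerivAt_update x i t)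
    rw [pderiv_eq_fderiv i (hG.differentiable (by simp))]
    exact h.ofReal_comp
  have hv : ∀ t : ℝ, HasDerivAt (fun s : ℝ => (starRingEnd ℂ) (phi d k (Function.update x i s)))
      (-(2 * π * Complex.I * k i) * (starRingEnd ℂ) (phi d k (Function.update x i t))) t := by
    intro t
    have h1 : HasDerivAt (fun s : ℝ => Complex.exp (-(2 * π * Complex.I * k i) * s))
        (Complex.exp (-(2 * π * Complex.I * k i) * t) * (-(2 * π * Complex.I * k i))) t := by
      have := ((Complex.ofRealCLM.hasDerivAt (x := t)).const_mul (-(2 * π * Complex.I * k i))).cexp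
      simpa using this
    obtain ⟨A, hA⟩ : ∃ A : ℂ, ∀ s : ℝ, (starRingEnd ℂ) (phi d k (Function.update x i s)) =
        A * Complex.exp (-(2 * π * Complex.I * k i) * s) := by
      refine ⟨(starRingEnd ℂ) (phi d k (Function.update x i 0)), fun s => ?_⟩
      rw [phi_update k i x s, map_mul, ← Complex.exp_conj]
      simp [Complex.conj_ofNat]
    simp only [hA]
    exact (h1.const_mul A).congr_deriv (by ring)
  have c1 : Continuous fun t : ℝ => (pderiv d i G (Function.update x i t) : ℂ) :=
    Complex.continuous_ofReal.comp (hG'.comp hupd)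
  have c2 : Continuous fun t : ℝ => (starRingEnd ℂ) (phi d k (Function.update x i t)) :=
    hw.comp hupd
  have c3 : Continuous fun t : ℝ => (G (Function.update x i t) : ℂ) :=
    Complex.continuous_ofReal.comp (hG.continuous.comp hupd)
  have key := intervalIntegral.integral_mul_deriv_eq_deriv_mul (a := 0) (b := 1)
    (fun t _ => hu t) (fun t _ => hv t) (c1.intervalIntegrable _ _)
    ((continuous_const.mul c2).intervalIntegrable _ _)
  have hphi : phi d k (Function.update x i 1) = phi d k (Function.update x i 0) := by
    rw [phi_update k i x 1, Complex.ofReal_one, mul_one, exp_two_pi_int, mul_one]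
  rw [hper x hx, hphi, sub_self, zero_sub] at key
  rw [← intervalIntegral.integral_const_mul, ← neg_inj, ← key, ← intervalIntegral.integral_neg]
  refine intervalIntegral.integral_congr fun t _ => ?_
  ring

lemma fCoeff_pderiv_iterate {d : ℕ} (i : Fin d) {G : (Fin d → ℝ) → ℝ} (q : ℕ)
    (hG : ContDiff ℝ q G)
    (hper : ∀ r < q, ∀ x ∈ cube d, (pderiv d i)^[r] G (Function.update x i 0) =
      (pderiv d i)^[r] G (Function.update x i 1))
    (k : Fin d → ℤ) :
    fCoeff d (fun x => ((pderiv d i)^[q] G x : ℂ)) k =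
      (2 * π * Complex.I * k i) ^ q * fCoeff d (fun x => (G x : ℂ)) k := by
  induction q with
  | zero => simp
  | succ q ih =>
    have h1 : ContDiff ℝ 1 ((pderiv d i)^[q] G) := by
      have := ContDiff.pderiv_iterate i q (n := 1) (by rwa [add_comm])
      simpa using this
    simp only [Function.iterate_succ_apply']
    rw [fCoeff_pderiv i h1 (hper q (Nat.lt_succ_self q)),
      ih (hG.of_le (by norm_cast; omega)) fun r hr => hper r (hr.trans (Nat.lt_succ_self q))]
    ring

lemma three_le_norm_exp_sub_one_sq {θ : ℝ} (h1 : 2 * π / 3 ≤ |θ|) (h2 : |θ| ≤ 4 * π / 3) :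
    3 ≤ ‖Complex.exp (θ * Complex.I) - 1‖ ^ 2 := by
  have hcos : Real.cos θ ≤ -(1 / 2) := by
    have hpi := Real.pi_pos
    have h : Real.cos (π / 3) ≤ Real.cos |(|θ| - π)| :=
      Real.cos_le_cos_of_nonneg_of_le_pi (abs_nonneg _) (by linarith)
        (abs_le.2 ⟨by linarith, by linarith⟩)
    rw [Real.cos_abs, Real.cos_sub_pi, Real.cos_abs, Real.cos_pi_div_three] at h
    linarith
  rw [← Complex.normSq_eq_norm_sq, Complex.normSq_apply]
  simp only [Complex.sub_re, Complex.sub_im, Complex.exp_ofReal_mul_I_re,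
    Complex.exp_ofReal_mul_I_im, Complex.one_re, Complex.one_im]
  nlinarith [Real.sin_sq_add_cos_sq θ]

lemma euclid_update {d : ℕ} (x : Fin d → ℝ) (i : Fin d) (s t : ℝ) :
    euclid d (Function.update x i s) (Function.update x i t) = |s - t| := by
  rw [euclid, Finset.sum_eq_single i, Function.update_self, Function.update_self, Real.sqrt_sq_eq_abs]
  · intro j _ hj
    simp [Function.update_of_ne hj]
  · simp

/-- Increments of a Hölder function on the cube under translation of one coordinate modulo one:
the Hölder bound may be lost by a factor two only when the translation wraps around. -/
lemma sq_shift_sub_le {d : ℕ} (i : Fin d) {g : (Fin d → ℝ) → ℝ} {H ν h : ℝ} (hν : 0 ≤ ν)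
    (hH : 0 ≤ H) (h0 : 0 ≤ h) (h1 : h < 1)
    (hg : ∀ x ∈ cube d, ∀ y ∈ cube d, |g x - g y| ≤ H * euclid d x y ^ ν)
    (hper : ∀ x ∈ cube d, g (Function.update x i 0) = g (Function.update x i 1))
    {x : Fin d → ℝ} (hx : x ∈ cube d) :
    (g (Function.update x i (Int.fract (x i + h))) - g x) ^ 2 ≤
      (H * h ^ ν) ^ 2 * (1 + 3 * (Set.Ici (1 - h)).indicator 1 (x i)) := by
  have hxi : x i ∈ Set.Icc (0 : ℝ) 1 := ⟨hx.1 i, hx.2 i⟩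
  have hB : 0 ≤ H * h ^ ν := by positivity
  have hline : ∀ s ∈ Set.Icc (0 : ℝ) 1, ∀ t ∈ Set.Icc (0 : ℝ) 1, |s - t| ≤ h →
      |g (Function.update x i s) - g (Function.update x i t)| ≤ H * h ^ ν := by
    intro s hs t ht hst
    refine (hg _ (update_mem_cube hx i hs) _ (update_mem_cube hx i ht)).trans ?_
    rw [euclid_update]
    gcongr
  have hself : g x = g (Function.update x i (x i)) := by rw [Function.update_eq_self]
  rcases lt_or_ge (x i + h) 1 with hlt | hge
  · have hf : Int.fract (x i + h) = x i + h := Int.fract_eq_self.2 ⟨by linarith [hxi.1], hlt⟩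
    have hb := hline (x i + h) ⟨by linarith [hxi.1], hlt.le⟩ (x i) hxi
      (by rw [add_sub_cancel_left, abs_of_nonneg h0])
    rw [Set.indicator_of_notMem (by simp; linarith), hf, hself]
    simpa using sq_le_sq' (abs_le.1 hb).1 (abs_le.1 hb).2
  · have hf : Int.fract (x i + h) = x i + h - 1 := by
      rw [← Int.fract_sub_one]
      exact Int.fract_eq_self.2 ⟨by linarith, by linarith [hxi.2]⟩
    have hb1 := hline (x i + h - 1) ⟨by linarith, by linarith [hxi.2]⟩ 0 ⟨le_rfl, zero_le_one⟩
      (by rw [abs_of_nonneg (by linarith)]; linarith [hxi.2])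
    have hb2 := hline 1 ⟨zero_le_one, le_rfl⟩ (x i) hxi
      (by rw [abs_of_nonneg (by linarith [hxi.2])]; linarith)
    rw [hper x hx] at hb1
    rw [Set.indicator_of_mem (by simp; linarith), hf, hself, Pi.one_apply]
    rw [abs_le] at hb1 hb2
    have := sq_le_sq' (a := g (Function.update x i (x i + h - 1)) - g (Function.update x i (x i)))
      (b := 2 * (H * h ^ ν)) (by linarith) (by linarith)
    linarith

lemma setIntegral_cube_indicator {d : ℕ} (i : Fin d) {h : ℝ} (h0 : 0 ≤ h) (h1 : h ≤ 1) :
    IntegrableOn (fun x : Fin d → ℝ => (Set.Ici (1 - h)).indicator (1 : ℝ → ℝ) (x i)) (cube d) ∧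
    ∫ x in cube d, (Set.Ici (1 - h)).indicator (1 : ℝ → ℝ) (x i) = h := by
  have hint : IntegrableOn (fun x : Fin d → ℝ => (Set.Ici (1 - h)).indicator (1 : ℝ → ℝ) (x i))
      (cube d) := by
    refine Integrable.of_bound ((((measurable_one (α := ℝ) (β := ℝ)).indicator measurableSet_Ici).comp
      (measurable_pi_apply i)).aestronglyMeasurable) 1 (Filter.Eventually.of_forall fun x => ?_)
    exact (norm_indicator_le_norm_self _ _).trans (by simp)
  refine ⟨hint, ?_⟩
  rw [setIntegral_cube_eq_update i hint]
  have : ∫ t in (0 : ℝ)..1, (Set.Ici (1 - h)).indicator (1 : ℝ → ℝ) t = h := by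
    rw [intervalIntegral.integral_of_le zero_le_one, ← integral_Icc_eq_integral_Ioc,
      integral_indicator_one measurableSet_Ici, measureReal_restrict_apply measurableSet_Ici]
    have hs : Set.Ici (1 - h) ∩ Set.Icc 0 1 = Set.Icc (1 - h) 1 := by
      ext t
      simp only [Set.mem_inter_iff, Set.mem_Ici, Set.mem_Icc]
      constructor
      · rintro ⟨a, b, c⟩; exact ⟨a, c⟩
      · rintro ⟨a, b⟩; exact ⟨a, by linarith, b⟩
    rw [hs, Real.volume_real_Icc_of_le (by linarith)]
    ring
  simp [Function.update_self, this]

lemma integral_sq_shift_sub_le {d : ℕ} (i : Fin d) {g : (Fin d → ℝ) → ℝ} {H ν h : ℝ} (hν : 0 ≤ ν)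
    (hH : 0 ≤ H) (h0 : 0 ≤ h) (h1 : h < 1)
    (hg : ∀ x ∈ cube d, ∀ y ∈ cube d, |g x - g y| ≤ H * euclid d x y ^ ν)
    (hper : ∀ x ∈ cube d, g (Function.update x i 0) = g (Function.update x i 1)) :
    ∫ x in cube d, (g (Function.update x i (Int.fract (x i + h))) - g x) ^ 2 ≤
      (H * h ^ ν) ^ 2 * (1 + 3 * h) := by
  obtain ⟨hint, hval⟩ := setIntegral_cube_indicator i h0 h1.le
  calc _ ≤ ∫ x in cube d, (H * h ^ ν) ^ 2 * (1 + 3 * (Set.Ici (1 - h)).indicator 1 (x i)) := by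
        refine integral_mono_of_nonneg (Filter.Eventually.of_forall fun x => sq_nonneg _)
          (((integrable_const _).add (hint.const_mul 3)).const_mul _) ?_
        filter_upwards [ae_restrict_mem (measurableSet_cube d)] with x hx
        exact sq_shift_sub_le i hν hH h0 h1 hg hper hx
    _ = _ := by
        rw [integral_const_mul, integral_add (integrable_const _) (hint.const_mul 3),
          integral_const_mul, hval]
        simp

lemma sum_norm_sq_fCoeff_dyadic_le {d : ℕ} (i : Fin d) {g : (Fin d → ℝ) → ℝ} (hc : Continuous g)
    {H ν : ℝ} (hν : 0 ≤ ν) (hH : 0 ≤ H)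
    (hg : ∀ x ∈ cube d, ∀ y ∈ cube d, |g x - g y| ≤ H * euclid d x y ^ ν)
    (hper : ∀ x ∈ cube d, g (Function.update x i 0) = g (Function.update x i 1))
    {K : ℝ} (hK : 1 ≤ K) (S : Finset (Fin d → ℤ))
    (hS : ∀ k ∈ S, K ≤ |(k i : ℝ)| ∧ |(k i : ℝ)| ≤ 2 * K) :
    ∑ k ∈ S, ‖fCoeff d (fun x => (g x : ℂ)) k‖ ^ 2 ≤ H ^ 2 * K ^ (-(2 * ν)) := by
  have hK0 : 0 < K := by linarith
  set h : ℝ := 1 / (3 * K) with hh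
  have h0 : 0 ≤ h := by positivity
  have h1 : h ≤ 1 / 3 := by
    rw [hh]; gcongr; linarith
  have hgc : Continuous fun x => (g x : ℂ) := Complex.continuous_ofReal.comp hc
  have hmeas := measurable_shift i h
  obtain ⟨C, hC⟩ := (isCompact_Icc (a := (0 : Fin d → ℝ)) (b := 1)).exists_bound_of_continuousOn
    hgc.continuousOn
  have hshift : MemLp (fun x => (g (Function.update x i (Int.fract (x i + h))) : ℂ)) 2
      (volume.restrict (cube d)) := by
    refine MemLp.of_bound (hgc.measurable.comp hmeas).aestronglyMeasurable C ?_
    filter_upwards [ae_restrict_mem (measurableSet_cube d)] with x hx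
    exact hC _ (update_mem_cube hx i ⟨Int.fract_nonneg _, (Int.fract_lt_one _).le⟩)
  have hgL : MemLp (fun x => (g x : ℂ)) 2 (volume.restrict (cube d)) := by
    refine MemLp.of_bound hgc.aestronglyMeasurable C ?_
    filter_upwards [ae_restrict_mem (measurableSet_cube d)] with x hx
    exact hC _ hx
  have hcoef : ∀ k, fCoeff d (fun x => (g (Function.update x i (Int.fract (x i + h))) : ℂ) - g x) k
      = (Complex.exp (2 * π * Complex.I * k i * h) - 1) * fCoeff d (fun x => (g x : ℂ)) k := by
    intro k
    rw [sub_mul, one_mul, ← fCoeff_shift i hgc h k, fCoeff, fCoeff, fCoeff, ← integral_sub]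
    · simp only [sub_mul]
    · refine (hshift.integrable one_le_two).mul_bdd (c := 1)
        (Complex.continuous_conj.comp (continuous_phi k)).aestronglyMeasurable
        (Filter.Eventually.of_forall fun x => ?_)
      simp [norm_phi]
    · refine (hgL.integrable one_le_two).mul_bdd (c := 1)
        (Complex.continuous_conj.comp (continuous_phi k)).aestronglyMeasurable
        (Filter.Eventually.of_forall fun x => ?_)
      simp [norm_phi]
  have hbes := sum_norm_sq_fCoeff_le (hshift.sub hgL) S
  have hlow : 3 * ∑ k ∈ S, ‖fCoeff d (fun x => (g x : ℂ)) k‖ ^ 2 ≤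
      ∑ k ∈ S, ‖fCoeff d (fun x => (g (Function.update x i (Int.fract (x i + h))) : ℂ) - g x) k‖ ^ 2
      := by
    rw [Finset.mul_sum]
    refine Finset.sum_le_sum fun k hk => ?_
    rw [hcoef, norm_mul, mul_pow]
    refine mul_le_mul_of_nonneg_right ?_ (sq_nonneg _)
    have hθ : (2 * π * Complex.I * k i * h : ℂ) = ((2 * π * (k i * h) : ℝ) : ℂ) * Complex.I := by
      push_cast; ring
    have hpi := Real.pi_pos
    have habs : |2 * π * (k i * h)| = 2 * π / 3 * (|(k i : ℝ)| / K) := by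
      rw [abs_mul, abs_mul (k i : ℝ), abs_of_pos (by positivity : 0 < 2 * π), abs_of_nonneg h0, hh]
      field_simp
    obtain ⟨ha, hb⟩ := hS k hk
    have ha' : 1 ≤ |(k i : ℝ)| / K := by rwa [le_div_iff₀ hK0, one_mul]
    have hb' : |(k i : ℝ)| / K ≤ 2 := by rwa [div_le_iff₀ hK0]
    rw [hθ]
    refine three_le_norm_exp_sub_one_sq ?_ ?_
    · rw [habs]; nlinarith
    · rw [habs]; nlinarith
  have hup : ∫ x in cube d, ‖(g (Function.update x i (Int.fract (x i + h))) : ℂ) - g x‖ ^ 2 ≤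
      (H * h ^ ν) ^ 2 * (1 + 3 * h) := by
    simp only [← Complex.ofReal_sub, Complex.norm_real, Real.norm_eq_abs, sq_abs]
    exact integral_sq_shift_sub_le i hν hH h0 (by linarith) hg hper
  have hpow : (h ^ ν) ^ 2 ≤ K ^ (-(2 * ν)) := by
    have : h ^ ν ≤ (K⁻¹) ^ ν := by
      refine Real.rpow_le_rpow h0 ?_ hν
      rw [hh, one_div]
      gcongr
      linarith
    calc (h ^ ν) ^ 2 ≤ ((K⁻¹) ^ ν) ^ 2 := by gcongr
      _ = _ := by
        rw [← Real.rpow_natCast, ← Real.rpow_mul (by positivity), Real.inv_rpow hK0.le,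
          ← Real.rpow_neg hK0.le]
        congr 1
        push_cast
        ring
  have hfin : (H * h ^ ν) ^ 2 * (1 + 3 * h) ≤ 3 * (H ^ 2 * K ^ (-(2 * ν))) := by
    calc _ ≤ (H ^ 2 * K ^ (-(2 * ν))) * 3 := by
          rw [mul_pow]
          gcongr
          linarith
      _ = _ := mul_comm _ _
  have := hlow.trans (hbes.trans (hup.trans hfin))
  linarith

lemma sum_norm_sq_fCoeff_tail_le {d : ℕ} (i : Fin d) {g : (Fin d → ℝ) → ℝ} (hc : Continuous g)
    {H ν : ℝ} (hν : 0 < ν) (hH : 0 ≤ H)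
    (hg : ∀ x ∈ cube d, ∀ y ∈ cube d, |g x - g y| ≤ H * euclid d x y ^ ν)
    (hper : ∀ x ∈ cube d, g (Function.update x i 0) = g (Function.update x i 1))
    {m : ℕ} (hm : 1 ≤ m) (S : Finset (Fin d → ℤ)) (hS : ∀ k ∈ S, m ≤ (k i).natAbs) :
    ∑ k ∈ S, ‖fCoeff d (fun x => (g x : ℂ)) k‖ ^ 2 ≤
      H ^ 2 * (m : ℝ) ^ (-(2 * ν)) / (1 - (2 : ℝ) ^ (-(2 * ν))) := by
  set q : ℝ := (2 : ℝ) ^ (-(2 * ν)) with hq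
  have hq0 : 0 < q := by positivity
  have hq1 : q < 1 := Real.rpow_lt_one_of_one_lt_of_neg one_lt_two (by linarith)
  have hm0 : (0 : ℝ) < m := by exact_mod_cast hm
  let lev : (Fin d → ℤ) → ℕ := fun k => Nat.log 2 ((k i).natAbs / m)
  rw [← Finset.sum_fiberwise_of_maps_to (t := S.image lev) (g := lev)
    fun k hk => Finset.mem_image_of_mem _ hk]
  calc _ ≤ ∑ j ∈ S.image lev, H ^ 2 * (m : ℝ) ^ (-(2 * ν)) * q ^ j := by
        refine Finset.sum_le_sum fun j _ => ?_
        have hpow : (1 : ℝ) ≤ 2 ^ j := one_le_pow₀ one_le_two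
        have hm1 : (1 : ℝ) ≤ m := by exact_mod_cast hm
        refine (sum_norm_sq_fCoeff_dyadic_le i hc hν.le hH hg hper (K := 2 ^ j * m)
          (by nlinarith) _ fun k hk => ?_).trans (le_of_eq ?_)
        · obtain ⟨hkS, hkj⟩ := Finset.mem_filter.1 hk
          simp only [lev] at hkj
          have hne : (k i).natAbs / m ≠ 0 := (Nat.div_pos (hS k hkS) hm).ne'
          have hlo := Nat.pow_log_le_self 2 hne
          have hhi := Nat.lt_pow_succ_log_self one_lt_two ((k i).natAbs / m)
          rw [hkj] at hlo hhi
          rw [Nat.le_div_iff_mul_le hm] at hlo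
          rw [Nat.div_lt_iff_lt_mul hm] at hhi
          have hcast : |(k i : ℝ)| = ((k i).natAbs : ℝ) := by
            rw [Nat.cast_natAbs, Int.cast_abs]
          rw [hcast]
          refine ⟨by exact_mod_cast hlo, ?_⟩
          have : ((k i).natAbs : ℝ) ≤ 2 ^ (j + 1) * m := by exact_mod_cast hhi.le
          rw [pow_succ] at this
          linarith
        · rw [Real.mul_rpow (by positivity) hm0.le, hq, ← Real.rpow_natCast 2 j,
            ← Real.rpow_natCast _ j, ← Real.rpow_mul zero_le_two, ← Real.rpow_mul zero_le_two,
            mul_comm (j : ℝ)]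
          ring
    _ ≤ H ^ 2 * (m : ℝ) ^ (-(2 * ν)) * (1 - q)⁻¹ := by
        rw [← Finset.mul_sum]
        refine mul_le_mul_of_nonneg_left ?_ (by positivity)
        rw [← tsum_geometric_of_lt_one hq0.le hq1]
        exact (summable_geometric_of_lt_one hq0.le hq1).sum_le_tsum _ fun j _ => by positivity
    _ = _ := (div_eq_mul_inv _ _).symm

lemma SobolevFracP.sum_norm_sq_fCoeff_le {d : ℕ} {β : ℝ} (hβ : (⌊β⌋₊ : ℝ) < β) {L : ℝ}
    {f : (Fin d → ℝ) → ℝ} (hf : SobolevFracP d β L f) (i : Fin d) {m : ℕ} (hm : 1 ≤ m)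
    (S : Finset (Fin d → ℤ)) (hS : ∀ k ∈ S, m ≤ (k i).natAbs) :
    ∑ k ∈ S, ‖fCoeff d (fun x => (f x : ℂ)) k‖ ^ 2 ≤
      ((2 * π) ^ (2 * ⌊β⌋₊))⁻¹ / (1 - (2 : ℝ) ^ (-(2 * (β - ⌊β⌋₊)))) *
        (m : ℝ) ^ (-(2 * β)) * L ^ 2 := by
  obtain ⟨hsm, ⟨H, hH, hsum⟩, hbd⟩ := hf
  set p := ⌊β⌋₊ with hp
  set ν : ℝ := β - p with hν
  have hν0 : 0 < ν := sub_pos.2 hβ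
  have hm0 : (0 : ℝ) < m := by exact_mod_cast hm
  have hsm' : ContDiff ℝ p f := by exact_mod_cast hsm
  have hsingle : ∀ r, ∑ j, (Pi.single i r : Fin d → ℕ) j = r := fun r => by simp
  have hmem : (Pi.single i p : Fin d → ℕ) ∈ multiIdx d p := by
    rw [multiIdx, Finset.mem_filter, Fintype.mem_piFinset]
    refine ⟨fun j => ?_, hsingle p⟩
    rw [Finset.mem_range, Nat.lt_succ_iff]
    exact (Finset.single_le_sum (fun _ _ => Nat.zero_le _) (Finset.mem_univ j)).trans
      (hsingle p).le
  have hper : ∀ r ≤ p, ∀ x ∈ cube d, (pderiv d i)^[r] f (Function.update x i 0) =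
      (pderiv d i)^[r] f (Function.update x i 1) := by
    intro r hr x hx
    have := hbd (Pi.single i r) (by rwa [hsingle]) _
      (update_mem_cube hx i (t := 0) ⟨le_rfl, zero_le_one⟩) i (by simp)
    simpa [mderiv_single] using this
  obtain ⟨hH0, hHol⟩ := hH _ hmem
  rw [mderiv_single] at hHol
  have hHL : H (Pi.single i p) ^ 2 ≤ L ^ 2 := by
    have h1 := Finset.single_le_sum (f := fun α => H α ^ 2) (fun α _ => sq_nonneg _) hmem
    have h2 : 0 ≤ ∑ α ∈ multiIdx d p, ∫ x in cube d, (mderiv d α f x) ^ 2 :=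
      Finset.sum_nonneg fun α _ => integral_nonneg fun x => sq_nonneg _
    linarith
  have hcont : Continuous ((pderiv d i)^[p] f) :=
    (ContDiff.pderiv_iterate (n := 0) i p (by simpa using hsm')).continuous
  have htail := sum_norm_sq_fCoeff_tail_le i hcont hν0 hH0 hHol (hper p le_rfl) hm S hS
  have hq1 : (2 : ℝ) ^ (-(2 * ν)) < 1 :=
    Real.rpow_lt_one_of_one_lt_of_neg one_lt_two (by linarith)
  have hlow : (2 * π * m) ^ (2 * p) * ∑ k ∈ S, ‖fCoeff d (fun x => (f x : ℂ)) k‖ ^ 2 ≤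
      ∑ k ∈ S, ‖fCoeff d (fun x => ((pderiv d i)^[p] f x : ℂ)) k‖ ^ 2 := by
    rw [Finset.mul_sum]
    refine Finset.sum_le_sum fun k hk => ?_
    rw [fCoeff_pderiv_iterate i p hsm' (fun r hr => hper r hr.le), norm_mul,
      mul_pow (‖_‖), norm_pow, ← pow_mul, mul_comm p 2]
    have hk' : (m : ℝ) ≤ |(k i : ℝ)| := by
      rw [← Int.cast_abs, ← Nat.cast_natAbs]
      exact_mod_cast hS k hk
    have hn : ‖(2 * π * Complex.I * k i : ℂ)‖ = 2 * π * |(k i : ℝ)| := by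
      simp [abs_of_pos Real.pi_pos]
    rw [hn]
    have := Real.pi_pos
    gcongr
  have hpos : 0 < (2 * π * m) ^ (2 * p) := by positivity
  have hmain := hlow.trans htail
  rw [mul_comm, ← le_div_iff₀ hpos] at hmain
  refine hmain.trans ?_
  have hexp : (m : ℝ) ^ (-(2 * β)) = (m : ℝ) ^ (-(2 * ν)) * ((m : ℝ) ^ (2 * p))⁻¹ := by
    rw [← Real.rpow_natCast, ← Real.rpow_neg hm0.le, ← Real.rpow_add hm0]
    congr 1
    rw [hν]
    push_cast
    ring
  have hD : 0 < 1 - (2 : ℝ) ^ (-(2 * ν)) := by linarith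
  calc _ = ((2 * π) ^ (2 * p))⁻¹ / (1 - (2 : ℝ) ^ (-(2 * ν))) *
        (m : ℝ) ^ (-(2 * β)) * H (Pi.single i p) ^ 2 := by
        rw [hexp, mul_pow]
        field_simp
    _ ≤ _ := by gcongr

/-- Fourier tail in fractional periodic Sobolev spaces. For
non-integer `β > 0` with fractional part `ν = β - ⌊β⌋ ∈ (0,1)` and every
`f ∈ S_L^p(β)` and `M ≥ 1`,
`Σ_{k ∉ {-M,…,M}^d} |θ_k(f)|² ≤ c(β) d (M+1)^{-2β} L²`, with the explicit constant
`c(β) = (2π)^{-2⌊β⌋} 2^{2ν} 3^{-ν} / (1 - 2^{-2ν})`, which does not depend on `d`. -/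
theorem stmt13 (d : ℕ) (hd : 1 ≤ d) (β : ℝ) (hβ : 0 < β)
    (hβnotint : (⌊β⌋₊ : ℝ) < β) (L : ℝ) (hL : 0 < L)
    (f : (Fin d → ℝ) → ℝ) (hf : SobolevFracP d β L f) (M : ℕ) (hM : 1 ≤ M) :
    ∑' k : {k : Fin d → ℤ // k ∉ box d M},
        ‖fCoeff d (fun x => (f x : ℂ)) (k : Fin d → ℤ)‖ ^ 2
      ≤ ((2 * Real.pi) ^ (2 * ⌊β⌋₊))⁻¹ * (2 : ℝ) ^ (2 * (β - ⌊β⌋₊)) *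
            (3 : ℝ) ^ (-(β - ⌊β⌋₊)) / (1 - (2 : ℝ) ^ (-(2 * (β - ⌊β⌋₊)))) *
          d * ((M : ℝ) + 1) ^ (-(2 * β)) * L ^ 2 := by

  have hν0 : 0 < β - ⌊β⌋₊ := sub_pos.2 hβnotint
  have hq1 : (2 : ℝ) ^ (-(2 * (β - ⌊β⌋₊))) < 1 :=
    Real.rpow_lt_one_of_one_lt_of_neg one_lt_two (by linarith)
  have hD : 0 < 1 - (2 : ℝ) ^ (-(2 * (β - ⌊β⌋₊))) := by linarith
  have hc : 1 ≤ (2 : ℝ) ^ (2 * (β - ⌊β⌋₊)) * (3 : ℝ) ^ (-(β - ⌊β⌋₊)) := by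
    rw [Real.rpow_mul zero_le_two, Real.rpow_neg (by norm_num), ← Real.inv_rpow (by norm_num),
      ← Real.mul_rpow (by positivity) (by norm_num)]
    exact Real.one_le_rpow (by norm_num) hν0.le
  set B : ℝ := ((2 * π) ^ (2 * ⌊β⌋₊))⁻¹ / (1 - (2 : ℝ) ^ (-(2 * (β - ⌊β⌋₊)))) *
        ((M + 1 : ℕ) : ℝ) ^ (-(2 * β)) * L ^ 2 with hB
  have hB0 : 0 ≤ B := by positivity
  have hrhs : ((2 * Real.pi) ^ (2 * ⌊β⌋₊))⁻¹ * (2 : ℝ) ^ (2 * (β - ⌊β⌋₊)) *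
            (3 : ℝ) ^ (-(β - ⌊β⌋₊)) / (1 - (2 : ℝ) ^ (-(2 * (β - ⌊β⌋₊)))) *
          d * ((M : ℝ) + 1) ^ (-(2 * β)) * L ^ 2 =
      (2 : ℝ) ^ (2 * (β - ⌊β⌋₊)) * (3 : ℝ) ^ (-(β - ⌊β⌋₊)) * (d * B) := by
    rw [hB]
    push_cast
    ring
  rw [hrhs]
  refine le_trans ?_ (le_mul_of_one_le_left (by positivity) hc)
  refine Real.tsum_le_of_sum_le (fun k => sq_nonneg _) fun T => ?_
  set S : Finset (Fin d → ℤ) := T.map (Function.Embedding.subtype _) with hSdef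
  have hS : ∀ k ∈ S, ∃ i, M + 1 ≤ (k i).natAbs := by
    intro k hk
    obtain ⟨⟨k', hk'⟩, -, rfl⟩ := Finset.mem_map.1 hk
    by_contra! hcon
    refine hk' (Fintype.mem_piFinset.2 fun i => Finset.mem_Icc.2 ?_)
    have := hcon i
    simp only [Function.Embedding.subtype_apply] at this
    omega
  calc ∑ k ∈ T, ‖fCoeff d (fun x => (f x : ℂ)) (k : Fin d → ℤ)‖ ^ 2
      = ∑ k ∈ S, ‖fCoeff d (fun x => (f x : ℂ)) k‖ ^ 2 := by
        rw [hSdef, Finset.sum_map]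
        rfl
    _ ≤ ∑ k ∈ S, ∑ i, if M + 1 ≤ (k i).natAbs then
          ‖fCoeff d (fun x => (f x : ℂ)) k‖ ^ 2 else 0 := by
        refine Finset.sum_le_sum fun k hk => ?_
        obtain ⟨i, hi⟩ := hS k hk
        refine le_trans (le_of_eq (if_pos hi).symm) (Finset.single_le_sum
          (f := fun i => if M + 1 ≤ (k i).natAbs then
            ‖fCoeff d (fun x => (f x : ℂ)) k‖ ^ 2 else 0) (fun j _ => ?_) (Finset.mem_univ i))
        positivity
    _ = ∑ i, ∑ k ∈ S.filter fun k => M + 1 ≤ (k i).natAbs,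
          ‖fCoeff d (fun x => (f x : ℂ)) k‖ ^ 2 := by
        rw [Finset.sum_comm]
        simp only [Finset.sum_filter]
    _ ≤ ∑ _i : Fin d, B :=
        Finset.sum_le_sum fun i _ => hf.sum_norm_sq_fCoeff_le hβnotint i (Nat.le_add_left 1 M) _
          fun k hk => (Finset.mem_filter.1 hk).2
    _ = d * B := by simp

end
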